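/- Assume 𝔸 = (−a_ij) and 𝔹 = (−b_ij) are positive definite on (1,…,1)^⊥, i.e. v·𝔸v > 0 and v·𝔹v > 0 for all nonzero v ∈ ℝ^N with Σᵢ vᵢ = 0. Fix h > 0. Then: (i) d_h is a metric on ℳ (after identifying functions equal almost everywhere): d_h(u,v)² ≥ 0 with d_h(u,v) = 0 if and only if u = v a.e., d_h is symmetric, and the triangle inequality d_h(u,w) ≤ d_h(u,v) + d_h(v,w) holds; (ii) (ℳ, d_h) is compact: every sequence in ℳ has a subsequence converging to some element of ℳ with respect to d_h; (iii) E_h is continuous with respect to d_h: if d_h(u^k, u) → 0 with u^k, u ∈ ℳ, then E_h(u^k) → E_h(u). -/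

import Mathlib

open Real MeasureTheory Filter Topology

/-- The `d`-dimensional heat kernel `G_t(z) = (4πt)^{-d/2} exp(-|z|²/(4t))`. -/
noncomputable def heatK (d : ℕ) (t : ℝ) (z : Fin d → ℝ) : ℝ :=
  (4 * Real.pi * t) ^ (-(d : ℝ) / 2) * Real.exp (-(∑ i, z i ^ 2) / (4 * t))

/-- The rescaled kernel `K^h_ij(z) = h^{-d/2}·(a_ij G_γ + b_ij G_β)(z/√h)`. -/
noncomputable def Khij (d : ℕ) (γ β aij bij h : ℝ) (z : Fin d → ℝ) : ℝ :=
  h ^ (-(d : ℝ) / 2) *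
    (aij * heatK d γ ((Real.sqrt h)⁻¹ • z) + bij * heatK d β ((Real.sqrt h)⁻¹ • z))

/-- Convolution `(K*u)(x) = ∫ K(z) u(x−z) dz`. -/
noncomputable def conv {d : ℕ} (K : (Fin d → ℝ) → ℝ) (u : (Fin d → ℝ) → ℝ)
    (x : Fin d → ℝ) : ℝ :=
  ∫ z, K z * u (x - z)

/-- The unit box `[0,1)^d`. -/
def unitBox (d : ℕ) : Set (Fin d → ℝ) := Set.univ.pi fun _ => Set.Ico (0 : ℝ) 1

/-- `ℤ^d`-periodicity. -/
def ZPeriodic {d : ℕ} {α : Type*} (u : (Fin d → ℝ) → α) : Prop :=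
  ∀ (x : Fin d → ℝ) (k : Fin d → ℤ), u (x + fun i => (k i : ℝ)) = u x

/-- Membership in `ℳ`: measurable `ℤ^d`-periodic functions with values in `[0,1]^N`
summing to `1` a.e. -/
def memM {d N : ℕ} (u : (Fin d → ℝ) → Fin N → ℝ) : Prop :=
  Measurable u ∧ ZPeriodic u ∧ (∀ x i, u x i ∈ Set.Icc (0 : ℝ) 1) ∧
    ∀ᵐ x ∂(volume : Measure (Fin d → ℝ)), ∑ i, u x i = 1

/-- Membership in `𝒜`: elements of `ℳ` with values in `{0,1}^N`. -/
def memA {d N : ℕ} (u : (Fin d → ℝ) → Fin N → ℝ) : Prop :=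
  memM u ∧ ∀ x i, u x i = 0 ∨ u x i = 1

/-- The approximate energy `E_h(u) = h^{-1/2} Σ_{i,j} ∫_{[0,1)^d} u_i K^h_ij * u_j dx`. -/
noncomputable def Eh {d N : ℕ} (γ β : ℝ) (a b : Fin N → Fin N → ℝ) (h : ℝ)
    (u : (Fin d → ℝ) → Fin N → ℝ) : ℝ :=
  (Real.sqrt h)⁻¹ * ∑ i, ∑ j, ∫ x in unitBox d,
    u x i * conv (Khij d γ β (a i j) (b i j) h) (fun y => u y j) x

/-- The squared distance
`d_h(u,v)² = -2√h Σ_{i,j} ∫_{[0,1)^d} (u_i-v_i) K^h_ij * (u_j-v_j) dx`. -/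
noncomputable def dsq {d N : ℕ} (γ β : ℝ) (a b : Fin N → Fin N → ℝ) (h : ℝ)
    (u v : (Fin d → ℝ) → Fin N → ℝ) : ℝ :=
  -2 * Real.sqrt h * ∑ i, ∑ j, ∫ x in unitBox d,
    (u x i - v x i) * conv (Khij d γ β (a i j) (b i j) h) (fun y => u y j - v y j) x

/-- The distance `d_h(u,v) = √(d_h(u,v)²)`. -/
noncomputable def dh {d N : ℕ} (γ β : ℝ) (a b : Fin N → Fin N → ℝ) (h : ℝ)
    (u v : (Fin d → ℝ) → Fin N → ℝ) : ℝ :=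
  Real.sqrt (dsq γ β a b h u v)


/-- Bounded measurable periodic scalar functions. -/
structure BP {d : ℕ} (f : (Fin d → ℝ) → ℝ) : Prop where
  meas : Measurable f
  per : ZPeriodic f
  bdd : ∃ C, 0 ≤ C ∧ ∀ x, |f x| ≤ C

abbrev latL (d : ℕ) := Submodule.span ℤ (Set.range (Pi.basisFun ℝ (Fin d)))

lemma latL_mem {d : ℕ} (g : latL d) : ∃ k : Fin d → ℤ, (g : Fin d → ℝ) = fun i => (k i : ℝ) := by
  have h := g.2
  rw [Module.Basis.mem_span_iff_repr_mem] at h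
  choose k hk using h
  refine ⟨k, ?_⟩
  funext i
  have := hk i
  simpa using this.symm

instance latL_countable (d : ℕ) : Countable (latL d) := by
  infer_instance

lemma box_fd (d : ℕ) : IsAddFundamentalDomain (latL d) (unitBox d)
    (volume : Measure (Fin d → ℝ)) := by
  have := ZSpan.isAddFundamentalDomain (Pi.basisFun ℝ (Fin d)) (volume : Measure (Fin d → ℝ))
  rwa [ZSpan.fundamentalDomain_pi_basisFun] at this

instance latL_inv (d : ℕ) : VAddInvariantMeasure (latL d) (Fin d → ℝ) volume :=
  inferInstanceAs <| VAddInvariantMeasure (latL d).toAddSubgroup (Fin d → ℝ) volume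

lemma box_meas (d : ℕ) : MeasurableSet (unitBox d) :=
  MeasurableSet.univ_pi fun _ => measurableSet_Ico

lemma box_vol (d : ℕ) : (volume : Measure (Fin d → ℝ)) (unitBox d) = 1 := by
  simp [unitBox, Real.volume_pi_Ico, volume_pi]

instance box_prob (d : ℕ) : IsProbabilityMeasure (volume.restrict (unitBox d)) :=
  ⟨by simp [box_vol]⟩

lemma per_vadd {d : ℕ} {α : Type*} {f : (Fin d → ℝ) → α} (hf : ZPeriodic f) (g : latL d)
    (x : Fin d → ℝ) : f (g +ᵥ x) = f x := by
  obtain ⟨k, hk⟩ := latL_mem g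
  rw [← hf x k, ← hk]
  congr 1
  exact add_comm _ _

open Pointwise in
lemma box_translate {d : ℕ} {f : (Fin d → ℝ) → ℝ} (hf : ZPeriodic f) (z : Fin d → ℝ) :
    ∫ x in unitBox d, f (x + z) = ∫ x in unitBox d, f x := by
  have h1 := (box_fd d).vadd_of_comm z
  have h2 := h1.setIntegral_eq (box_fd d) (fun g x => per_vadd hf g x)
  rw [← h2]
  have h3 : (z +ᵥ unitBox d) = (fun x => x + z) '' unitBox d := by
    ext x; simp only [Set.mem_vadd_set, Set.mem_image, vadd_eq_add, add_comm z]
  rw [h3]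
  exact ((measurePreserving_add_right volume z).setIntegral_image_emb
    (measurableEmbedding_addRight z) _ _).symm

lemma ae_of_box {d : ℕ} {p : (Fin d → ℝ) → Prop} (hp : ZPeriodic p)
    (h : ∀ᵐ x ∂(volume.restrict (unitBox d)), p x) : ∀ᵐ x, p x := by
  rw [ae_iff]
  rw [ae_restrict_iff' (box_meas d), ae_iff] at h
  refine (box_fd d).measure_zero_of_invariant _ (fun g => ?_) ?_
  · ext x
    rw [Set.mem_vadd_set_iff_neg_vadd_mem]
    simp only [Set.mem_ofPred_eq]
    rw [per_vadd hp]
  · convert h using 2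
    ext x; simp; tauto

/-- unnormalized Gaussian -/
noncomputable def gs {d : ℕ} (t : ℝ) (z : Fin d → ℝ) : ℝ := Real.exp (-(∑ i, z i ^ 2) / (4 * t))

lemma gs_meas {d : ℕ} (t : ℝ) : Measurable (gs t : (Fin d → ℝ) → ℝ) := by
  unfold gs; fun_prop

lemma gs_pos {d : ℕ} (t : ℝ) (z : Fin d → ℝ) : 0 < gs t z := Real.exp_pos _

lemma gs_neg {d : ℕ} (t : ℝ) (z : Fin d → ℝ) : gs t (-z) = gs t z := by
  simp [gs]

lemma gs_le_one {d : ℕ} {t : ℝ} (ht : 0 < t) (z : Fin d → ℝ) : gs t z ≤ 1 := by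
  unfold gs
  rw [Real.exp_le_one_iff]
  apply div_nonpos_of_nonpos_of_nonneg
  · simpa using Finset.sum_nonneg fun i _ => sq_nonneg (z i)
  · positivity

lemma gs_int {d : ℕ} {t : ℝ} (ht : 0 < t) : Integrable (gs t : (Fin d → ℝ) → ℝ) := by
  have h : ∀ i : Fin d, Integrable (fun x : ℝ => Real.exp (-(1 / (4 * t)) * x ^ 2)) :=
    fun _ => integrable_exp_neg_mul_sq (by positivity)
  have := Integrable.fintype_prod (f := fun _ : Fin d => fun x : ℝ => Real.exp (-(1 / (4 * t)) * x ^ 2))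
    (μ := fun _ => volume) h
  refine this.congr (ae_of_all _ fun z => ?_)
  simp only [gs]
  rw [← Real.exp_sum, ← Finset.mul_sum]
  congr 1; ring

lemma conv_integrable {d : ℕ} {K f : (Fin d → ℝ) → ℝ} (hK : Integrable K) (hf : BP f)
    (x : Fin d → ℝ) : Integrable (fun z => K z * f (x - z)) := by
  obtain ⟨C, _, hC⟩ := hf.bdd
  refine hK.mul_bdd (c := C) ?_ (ae_of_all _ fun z => hC _)
  have := hf.meas
  exact (by fun_prop : Measurable fun z => f (x - z)).aestronglyMeasurable

lemma conv_bdd {d : ℕ} {K f : (Fin d → ℝ) → ℝ} (hK : Integrable K) {C : ℝ}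
    (hf : ∀ x, |f x| ≤ C) (x : Fin d → ℝ) : |conv K f x| ≤ (∫ z, |K z|) * C := by
  unfold conv
  have e : (∫ z, |K z|) * C = ∫ z, |K z| * C := (integral_mul_const _ _).symm
  rw [e, ← Real.norm_eq_abs (∫ z, K z * f (x - z))]
  refine norm_integral_le_of_norm_le (hK.abs.mul_const C) (ae_of_all _ fun z => ?_)
  rw [Real.norm_eq_abs, abs_mul]
  exact mul_le_mul_of_nonneg_left (hf _) (abs_nonneg _)

lemma BP.conv {d : ℕ} {K f : (Fin d → ℝ) → ℝ} (hKm : Measurable K) (hK : Integrable K)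
    (hf : BP f) : BP (conv K f) := by
  refine ⟨?_, ?_, ?_⟩
  · have := hf.meas
    have h : StronglyMeasurable (fun p : (Fin d → ℝ) × (Fin d → ℝ) => K p.2 * f (p.1 - p.2)) :=
      (by fun_prop : Measurable _).stronglyMeasurable
    exact (h.integral_prod_right (ν := volume)).measurable
  · intro x k
    unfold _root_.conv
    congr 1; funext z
    rw [← hf.per (x - z) k]
    congr 2; abel
  · obtain ⟨C, hC0, hC⟩ := hf.bdd
    exact ⟨_, mul_nonneg (integral_nonneg fun _ => abs_nonneg _) hC0, conv_bdd hK hC⟩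

lemma BP.add {d : ℕ} {f g : (Fin d → ℝ) → ℝ} (hf : BP f) (hg : BP g) :
    BP (fun x => f x + g x) := by
  obtain ⟨C, h0, hC⟩ := hf.bdd
  obtain ⟨D, h1, hD⟩ := hg.bdd
  exact ⟨hf.meas.add hg.meas, fun x k => by simp only [hf.per x k, hg.per x k], C + D, by positivity,
    fun x => (abs_add_le _ _).trans (add_le_add (hC x) (hD x))⟩

lemma BP.mul {d : ℕ} {f g : (Fin d → ℝ) → ℝ} (hf : BP f) (hg : BP g) :
    BP (fun x => f x * g x) := by
  obtain ⟨C, h0, hC⟩ := hf.bdd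
  obtain ⟨D, h1, hD⟩ := hg.bdd
  refine ⟨hf.meas.mul hg.meas, fun x k => by simp only [hf.per x k, hg.per x k], C * D, by positivity,
    fun x => ?_⟩
  rw [abs_mul]
  exact mul_le_mul (hC x) (hD x) (abs_nonneg _) h0

lemma BP.const {d : ℕ} (c : ℝ) : BP (fun _ : Fin d → ℝ => c) :=
  ⟨measurable_const, fun _ _ => rfl, |c|, abs_nonneg _, fun _ => le_rfl⟩

lemma BP.sub {d : ℕ} {f g : (Fin d → ℝ) → ℝ} (hf : BP f) (hg : BP g) :
    BP (fun x => f x - g x) := by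
  convert hf.add ((BP.const (-1)).mul hg) using 2
  ring

lemma BP.int {d : ℕ} {f : (Fin d → ℝ) → ℝ} (hf : BP f) : IntegrableOn f (unitBox d) := by
  obtain ⟨C, h0, hC⟩ := hf.bdd
  exact Integrable.of_bound hf.meas.aestronglyMeasurable C (ae_of_all _ hC)

lemma BP.shift {d : ℕ} {f : (Fin d → ℝ) → ℝ} (hf : BP f) (z : Fin d → ℝ) :
    BP (fun x => f (x - z)) := by
  obtain ⟨C, h0, hC⟩ := hf.bdd
  refine ⟨hf.meas.comp (by fun_prop), fun x k => ?_, C, h0, fun x => hC _⟩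
  rw [← hf.per (x - z) k]
  congr 1; abel

lemma q_swap {d : ℕ} {K f g : (Fin d → ℝ) → ℝ} (hK : Integrable K) (hKm : Measurable K)
    (hf : BP f) (hg : BP g) :
    ∫ x in unitBox d, f x * conv K g x = ∫ z, K z * ∫ x in unitBox d, f x * g (x - z) := by
  unfold conv
  simp_rw [← integral_const_mul]
  rw [integral_integral_swap]
  · congr 1; funext z; congr 1; funext x; ring
  · obtain ⟨C, h0, hC⟩ := hf.bdd
    obtain ⟨D, h1, hD⟩ := hg.bdd
    have hfm := hf.meas
    have hgm := hg.meas
    have h2 : Integrable (fun p : (Fin d → ℝ) × (Fin d → ℝ) => K p.2)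
      ((volume.restrict (unitBox d)).prod volume) := hK.comp_snd _
    have h3 := h2.mul_bdd (g := fun p => f p.1 * g (p.1 - p.2)) (c := C * D)
      (by fun_prop : Measurable _).aestronglyMeasurable (ae_of_all _ fun p => by
        rw [Real.norm_eq_abs, abs_mul]
        exact mul_le_mul (hC _) (hD _) (abs_nonneg _) h0)
    refine h3.congr (ae_of_all _ fun p => ?_)
    simp only [Function.uncurry]; ring

lemma q_symm {d : ℕ} {K f g : (Fin d → ℝ) → ℝ} (hK : Integrable K) (hKm : Measurable K)
    (hKn : ∀ z, K (-z) = K z) (hf : BP f) (hg : BP g) :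
    ∫ x in unitBox d, f x * conv K g x = ∫ x in unitBox d, g x * conv K f x := by
  rw [q_swap hK hKm hf hg, q_swap hK hKm hg hf,
    ← integral_neg_eq_self (fun z => K z * ∫ x in unitBox d, g x * f (x - z))]
  congr 1; funext z
  rw [hKn]
  congr 1
  rw [← box_translate (hf.mul (hg.shift z)).per z]
  congr 1; funext x
  rw [add_sub_cancel_right, sub_neg_eq_add, mul_comm]

/-- normalisation constant -/
noncomputable def cg (d : ℕ) (t : ℝ) : ℝ := ∫ z : Fin d → ℝ, gs (t / 2) z

lemma cg_pos (d : ℕ) {t : ℝ} (ht : 0 < t) : 0 < cg d t := by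
  unfold cg
  have h := gs_int (d := d) (half_pos ht)
  rw [integral_pos_iff_support_of_nonneg (fun z => (gs_pos _ z).le) h]
  have : Function.support (gs (t/2) : (Fin d → ℝ) → ℝ) = Set.univ := by
    ext z; simp [(gs_pos (t/2) z).ne']
  rw [this]
  exact Measure.measure_univ_pos.2 (NeZero.ne _)

lemma gs_conv {d : ℕ} {t : ℝ} (ht : 0 < t) (y : Fin d → ℝ) :
    ∫ z, gs t z * gs t (y - z) = cg d t * gs (2 * t) y := by
  unfold cg
  rw [← integral_mul_const, ← integral_sub_right_eq_self (fun z => gs (t / 2) z * gs (2 * t) y) ((1/2 : ℝ) • y)]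
  congr 1; funext z
  simp only [gs]
  rw [← Real.exp_add, ← Real.exp_add]
  congr 1
  field_simp
  simp only [← Finset.sum_neg_distrib, ← Finset.sum_add_distrib, Finset.mul_sum,
    Finset.sum_mul, ← Finset.sum_sub_distrib, Finset.sum_div]
  refine Finset.sum_congr rfl fun i _ => ?_
  simp only [Pi.sub_apply, Pi.smul_apply, smul_eq_mul]
  field_simp
  ring

lemma semigroup {d : ℕ} {t : ℝ} (ht : 0 < t) {f : (Fin d → ℝ) → ℝ} (hf : BP f) (x : Fin d → ℝ) :
    conv (gs t) (conv (gs t) f) x = cg d t * conv (gs (2 * t)) f x := by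
  unfold conv
  rw [← integral_const_mul]
  have h1 : ∀ z : Fin d → ℝ, ∫ y, gs t y * f (x - z - y) = ∫ y, gs t (y - z) * f (x - y) := by
    intro z
    rw [← integral_sub_right_eq_self _ z]
    congr 1; funext y
    congr 2; abel
  simp_rw [h1, ← integral_const_mul]
  obtain ⟨C, h0, hC⟩ := hf.bdd
  have hfm := hf.meas
  have hgm := gs_meas (d := d) t
  rw [integral_integral_swap]
  · congr 1; funext y
    rw [← mul_assoc, ← gs_conv ht, ← integral_mul_const]
    congr 1; funext z; ring
  · have h2 := (Integrable.convolution_integrand (ContinuousLinearMap.mul ℝ ℝ)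
      (gs_int (d := d) ht) (gs_int (d := d) ht)).swap
    have h3 := h2.mul_bdd (g := fun p => f (x - p.2)) (c := C)
      (by fun_prop : Measurable _).aestronglyMeasurable (ae_of_all _ fun p => hC _)
    refine h3.congr (ae_of_all _ fun p => ?_)
    simp [Function.uncurry]; ring

lemma q_double {d : ℕ} {t : ℝ} (ht : 0 < t) {f g : (Fin d → ℝ) → ℝ} (hf : BP f) (hg : BP g) :
    cg d t * ∫ x in unitBox d, f x * conv (gs (2 * t)) g x =
      ∫ x in unitBox d, conv (gs t) f x * conv (gs t) g x := by
  have hg' := hg.conv (gs_meas t) (gs_int ht)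
  have := q_symm (gs_int ht) (gs_meas t) (gs_neg t) hf hg'
  rw [← integral_const_mul]
  simp_rw [mul_comm (conv (gs t) f _)]
  rw [← this]
  congr 1; funext x
  rw [semigroup ht hg]; ring

lemma gs_scale {d : ℕ} {s : ℝ} (hs : 0 < s) (z : Fin d → ℝ) :
    gs s (Real.sqrt s • z) = gs 1 z := by
  unfold gs
  congr 1
  simp only [Pi.smul_apply, smul_eq_mul, mul_pow, Real.sq_sqrt hs.le, ← Finset.mul_sum]
  field_simp

lemma test_swap {d : ℕ} {K φ w : (Fin d → ℝ) → ℝ} (hK : Integrable K)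
    (hφ : Integrable φ) (hw : BP w) :
    ∫ x, φ x * conv K w x = ∫ z, K z * ∫ x, φ x * w (x - z) := by
  unfold conv
  simp_rw [← integral_const_mul]
  rw [integral_integral_swap]
  · congr 1; funext z; congr 1; funext x; ring
  · obtain ⟨D, h1, hD⟩ := hw.bdd
    have hgm := hw.meas
    have h3 := (hφ.mul_prod hK).mul_bdd (g := fun p => w (p.1 - p.2)) (c := D)
      (by fun_prop : Measurable _).aestronglyMeasurable (ae_of_all _ fun p => hD _)
    refine h3.congr (ae_of_all _ fun p => ?_)
    simp only [Function.uncurry]; ring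

lemma H_cont {d : ℕ} {φ w : (Fin d → ℝ) → ℝ} (hφ : Continuous φ) (hc : HasCompactSupport φ)
    (hw : BP w) : Continuous fun z => ∫ x, φ x * w (x - z) := by
  obtain ⟨D, h1, hD⟩ := hw.bdd
  have hwm := hw.meas
  have hl : LocallyIntegrable (fun y => w (-y)) := by
    have := (locallyIntegrable_const (μ := (volume : Measure (Fin d → ℝ))) D)
    refine this.mono (by fun_prop : Measurable _).aestronglyMeasurable (ae_of_all _ fun x => ?_)
    rw [Real.norm_eq_abs, Real.norm_eq_abs, abs_of_nonneg h1]; exact hD _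
  have := hc.continuous_convolution_left (ContinuousLinearMap.mul ℝ ℝ) hφ hl
  convert this using 2 with z
  unfold convolution
  congr 1; funext x
  simp

lemma approx_zero {d : ℕ} {w φ : (Fin d → ℝ) → ℝ} (hw : BP w) {s : ℕ → ℝ} (hs : ∀ n, 0 < s n)
    (hs0 : Tendsto s atTop (𝓝 0)) (h : ∀ n, ∀ᵐ x, conv (gs (s n)) w x = 0)
    (hφ : Continuous φ) (hc : HasCompactSupport φ) : ∫ x, φ x * w x = 0 := by
  set H : (Fin d → ℝ) → ℝ := fun z => ∫ x, φ x * w (x - z) with hH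
  have hHc : Continuous H := H_cont hφ hc hw
  obtain ⟨D, h1, hD⟩ := hw.bdd
  have hφi : Integrable φ := hφ.integrable_of_hasCompactSupport hc
  have hHb : ∀ z, ‖H z‖ ≤ ∫ x, ‖φ x‖ * D := by
    intro z
    refine norm_integral_le_of_norm_le (hφi.norm.mul_const D) (ae_of_all _ fun x => ?_)
    rw [norm_mul]
    exact mul_le_mul_of_nonneg_left (hD _) (norm_nonneg _)
  have h0 : ∀ n, ∫ z, gs 1 z * H (Real.sqrt (s n) • z) = 0 := by
    intro n
    have e1 : ∫ z, gs (s n) z * H z = 0 := by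
      rw [← test_swap (gs_int (hs n)) hφi hw]
      rw [integral_eq_zero_of_ae]
      filter_upwards [h n] with x hx
      simp [hx]
    have e2 := Measure.integral_comp_smul (volume : Measure (Fin d → ℝ))
      (fun z => gs (s n) z * H z) (Real.sqrt (s n))
    rw [e1, smul_zero] at e2
    rw [← e2]
    congr 1; funext z
    rw [gs_scale (hs n)]
  have hlim : Tendsto (fun n => ∫ z, gs 1 z * H (Real.sqrt (s n) • z)) atTop
      (𝓝 (∫ z : Fin d → ℝ, gs 1 z * H 0)) := by
    have hgm := gs_meas (d := d) 1
    have hHm := hHc.measurable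
    refine tendsto_integral_of_dominated_convergence (fun z => gs 1 z * ∫ x, ‖φ x‖ * D)
      (fun n => (by fun_prop : Measurable _).aestronglyMeasurable)
      ((gs_int one_pos).mul_const _) (fun n => ae_of_all _ fun z => ?_) (ae_of_all _ fun z => ?_)
    · rw [norm_mul, Real.norm_of_nonneg (gs_pos _ _).le]
      exact mul_le_mul_of_nonneg_left (hHb _) (gs_pos _ _).le
    · refine Tendsto.const_mul _ ?_
      have : Tendsto (fun n => Real.sqrt (s n) • z) atTop (𝓝 0) := by
        have h2 := (Real.continuous_sqrt.tendsto 0).comp hs0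
        rw [Real.sqrt_zero] at h2
        simpa using h2.smul_const z
      exact (hHc.tendsto 0).comp this
  simp_rw [h0] at hlim
  have e := tendsto_nhds_unique hlim tendsto_const_nhds
  rw [integral_mul_const] at e
  have hp : (∫ z : Fin d → ℝ, gs 1 z) ≠ 0 := by
    have := (cg_pos d (t := 2) two_pos).ne'
    unfold cg at this
    norm_num at this ⊢
    exact this
  have := (mul_eq_zero.1 e).resolve_left hp
  simpa [hH] using this

lemma conv_zero_of_q {d : ℕ} {w : (Fin d → ℝ) → ℝ} (hw : BP w) {t : ℝ} (ht : 0 < t)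
    (h : ∫ x in unitBox d, w x * conv (gs t) w x = 0) : ∀ᵐ x, conv (gs (t / 2)) w x = 0 := by
  have ht2 := half_pos ht
  have h1 := q_double ht2 hw hw
  rw [mul_div_cancel₀ t two_ne_zero, h, mul_zero] at h1
  have hb := hw.conv (gs_meas (t / 2)) (gs_int ht2)
  have h2 := (integral_eq_zero_iff_of_nonneg (fun x => mul_self_nonneg _) (hb.mul hb).int).1 h1.symm
  refine ae_of_box (p := fun x => conv (gs (t / 2)) w x = 0) (fun x k => ?_) ?_
  · simp only [hb.per x k]
  · filter_upwards [h2] with x hx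
    simpa using hx

lemma q_inj {d : ℕ} {w : (Fin d → ℝ) → ℝ} (hw : BP w) {t : ℝ} (ht : 0 < t)
    (h : ∫ x in unitBox d, w x * conv (gs t) w x = 0) : ∀ᵐ x, w x = 0 := by
  have hn : ∀ n : ℕ, ∫ x in unitBox d, w x * conv (gs (t / 2 ^ n)) w x = 0 := by
    intro n
    induction n with
    | zero => simpa using h
    | succ n ih =>
      have := conv_zero_of_q hw (by positivity) ih
      rw [div_div, ← pow_succ] at this
      rw [integral_eq_zero_of_ae]
      filter_upwards [ae_restrict_of_ae this] with x hx
      simp [hx]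
  have hc : ∀ n : ℕ, ∀ᵐ x, conv (gs (t / 2 ^ (n + 1))) w x = 0 := by
    intro n
    have := conv_zero_of_q hw (by positivity) (hn n)
    rwa [div_div, ← pow_succ] at this
  have hs0 : Tendsto (fun n : ℕ => t / 2 ^ (n + 1)) atTop (𝓝 0) := by
    have h1 : Tendsto (fun n : ℕ => t * (1 / 2 : ℝ) ^ n) atTop (𝓝 (t * 0)) :=
      (tendsto_pow_atTop_nhds_zero_of_lt_one (by norm_num) (by norm_num)).const_mul t
    rw [mul_zero] at h1
    have h2 := h1.comp (tendsto_add_atTop_nat 1)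
    refine h2.congr fun n => ?_
    simp [div_eq_mul_inv]
  obtain ⟨D, h1, hD⟩ := hw.bdd
  have hl : LocallyIntegrable w := by
    have := (locallyIntegrable_const (μ := (volume : Measure (Fin d → ℝ))) D)
    refine this.mono hw.meas.aestronglyMeasurable (ae_of_all _ fun x => ?_)
    rw [Real.norm_eq_abs, Real.norm_eq_abs, abs_of_nonneg h1]; exact hD _
  refine ae_eq_zero_of_integral_contDiff_smul_eq_zero hl fun g hg hgc => ?_
  exact approx_zero hw (fun n => by positivity) hs0 hc hg.continuous hgc

/-- weak convergence tested against bounded measurable functions -/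
def WC {d : ℕ} (f : ℕ → (Fin d → ℝ) → ℝ) (g : (Fin d → ℝ) → ℝ) : Prop :=
  ∀ φ : (Fin d → ℝ) → ℝ, Measurable φ → (∃ C, ∀ x, |φ x| ≤ C) →
    Tendsto (fun k => ∫ x in unitBox d, φ x * f k x) atTop (𝓝 (∫ x in unitBox d, φ x * g x))

lemma conv_tsum {d : ℕ} {t : ℝ} (ht : 0 < t) {f : (Fin d → ℝ) → ℝ} (hf : BP f) (x : Fin d → ℝ) :
    conv (gs t) f x = ∑' l : latL d, ∫ y in unitBox d, gs t (x - ((l : Fin d → ℝ) + y)) * f y := by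
  unfold conv
  have h1 : ∫ z, gs t z * f (x - z) = ∫ y, gs t (x - y) * f y := by
    rw [← integral_sub_left_eq_self _ volume x]
    simp
  have hi : Integrable (fun y => gs t (x - y) * f y) := by
    have := (conv_integrable (gs_int ht) hf x).comp_sub_left x
    simpa using this
  rw [h1, (box_fd d).integral_eq_tsum'' _ hi]
  congr 1; funext l; congr 1; funext y
  rw [per_vadd hf.per]
  rfl

lemma gs_summable {d : ℕ} {t : ℝ} (ht : 0 < t) (x : Fin d → ℝ) :
    Summable fun l : latL d => ∫ y in unitBox d, gs t (x - ((l : Fin d → ℝ) + y)) := by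
  have hi : Integrable (fun y => gs t (x - y)) := (gs_int ht).comp_sub_left x
  have h1 := (box_fd d).lintegral_eq_tsum'' (fun y => ENNReal.ofReal (gs t (x - y)))
  have h2 : ∫⁻ y, ENNReal.ofReal (gs t (x - y)) ≠ ⊤ := by
    have := hi.lintegral_lt_top
    exact this.ne
  rw [h1] at h2
  have h3 := ENNReal.summable_toReal h2
  refine h3.congr fun l => ?_
  rw [integral_eq_lintegral_of_nonneg_ae (ae_of_all _ fun y => (gs_pos _ _).le)]
  · rfl
  · have := gs_meas (d := d) t
    exact (by fun_prop : Measurable _).aestronglyMeasurable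

lemma conv_wc {d : ℕ} {t : ℝ} (ht : 0 < t) {f : ℕ → (Fin d → ℝ) → ℝ} {g : (Fin d → ℝ) → ℝ}
    (hf : ∀ k, BP (f k)) (hg : BP g) {C : ℝ} (hC : ∀ k x, |f k x| ≤ C) (h : WC f g)
    (x : Fin d → ℝ) : Tendsto (fun k => conv (gs t) (f k) x) atTop (𝓝 (conv (gs t) g x)) := by
  simp_rw [conv_tsum ht (hf _), conv_tsum ht hg]
  have hm := gs_meas (d := d) t
  refine tendsto_tsum_of_dominated_convergence ((gs_summable ht x).mul_right C) (fun l => ?_)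
    (Eventually.of_forall fun k l => ?_)
  · refine h (fun y => gs t (x - ((l : Fin d → ℝ) + y))) (by fun_prop) ⟨1, fun y => ?_⟩
    rw [abs_of_pos (gs_pos _ _)]
    exact gs_le_one ht _
  · have e : (∫ y in unitBox d, gs t (x - ((l : Fin d → ℝ) + y))) * C = ∫ y in unitBox d, gs t (x - ((l : Fin d → ℝ) + y)) * C :=
      (integral_mul_const _ _).symm
    rw [e]
    have hi : Integrable (fun y => gs t (x - ((l : Fin d → ℝ) + y))) := by
      have := (gs_int ht).comp_sub_left (x - (l : Fin d → ℝ))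
      refine this.congr (ae_of_all _ fun y => ?_)
      simp only [sub_sub]
    refine norm_integral_le_of_norm_le (hi.integrableOn.mul_const C) (ae_of_all _ fun y => ?_)
    rw [norm_mul, Real.norm_of_nonneg (gs_pos _ _).le]
    exact mul_le_mul_of_nonneg_left (hC _ _) (gs_pos _ _).le

lemma q_wc {d : ℕ} {t : ℝ} (ht : 0 < t) {f f' : ℕ → (Fin d → ℝ) → ℝ} {g g' : (Fin d → ℝ) → ℝ}
    (hf : ∀ k, BP (f k)) {C : ℝ} (hC : ∀ k x, |f k x| ≤ C) (h : WC f g)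
    (hf' : ∀ k, BP (f' k)) (hg' : BP g') (hC' : ∀ k x, |f' k x| ≤ C) (h' : WC f' g') :
    Tendsto (fun k => ∫ x in unitBox d, f k x * conv (gs t) (f' k) x) atTop
      (𝓝 (∫ x in unitBox d, g x * conv (gs t) g' x)) := by
  have hcg := hg'.conv (gs_meas t) (gs_int ht)
  have hcf := fun k => (hf' k).conv (gs_meas t) (gs_int ht)
  have hC0 : 0 ≤ C := (abs_nonneg _).trans (hC 0 0)
  obtain ⟨D, hD0, hD⟩ := hcg.bdd
  have h1 := h _ hcg.meas ⟨D, hD⟩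
  have h2 : Tendsto (fun k => ∫ x in unitBox d, f k x * (conv (gs t) (f' k) x - conv (gs t) g' x))
      atTop (𝓝 (∫ x in unitBox d, (0 : ℝ))) := by
    refine tendsto_integral_of_dominated_convergence
      (fun _ => C * ((∫ z : Fin d → ℝ, |gs t z|) * C + D))
      (fun k => ((hf k).mul ((hcf k).sub hcg)).meas.aestronglyMeasurable) (integrable_const _)
      (fun k => ae_of_all _ fun x => ?_) (ae_of_all _ fun x => ?_)
    · rw [norm_mul]
      refine mul_le_mul (hC k x) ?_ (norm_nonneg _) hC0
      refine (norm_sub_le _ _).trans (add_le_add ?_ (hD x))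
      exact conv_bdd (gs_int ht) (hC' k) x
    · have h3 : Tendsto (fun k => conv (gs t) (f' k) x - conv (gs t) g' x) atTop (𝓝 0) := by
        simpa using (conv_wc ht hf' hg' hC' h' x).sub_const (conv (gs t) g' x)
      refine bdd_le_mul_tendsto_zero' C (Eventually.of_forall fun k => hC k x) h3
  have h4 := h2.add h1
  simp only [integral_zero, zero_add] at h4
  have e : (∫ x in unitBox d, g x * conv (gs t) g' x) = ∫ x in unitBox d, conv (gs t) g' x * g x := by
    congr 1; funext x; ring
  rw [e]
  refine h4.congr fun k => ?_
  rw [← integral_add ((hf k).mul ((hcf k).sub hcg)).int (hcg.mul (hf k)).int]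
  congr 1; funext x; ring

lemma weak_compact1 {d : ℕ} (f : ℕ → (Fin d → ℝ) → ℝ) (hm : ∀ k, Measurable (f k))
    (hb : ∀ k x, |f k x| ≤ 1) : ∃ φ : ℕ → ℕ, StrictMono φ ∧ ∃ g : (Fin d → ℝ) → ℝ,
      Measurable g ∧ IntegrableOn g (unitBox d) ∧ WC (fun k => f (φ k)) g := by
  set μ : Measure (Fin d → ℝ) := volume.restrict (unitBox d) with hμ
  have hL : ∀ k, MemLp (f k) 2 μ := fun k =>
    MemLp.of_bound (hm k).aestronglyMeasurable 1 (ae_of_all _ (hb k))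
  let F : ℕ → Lp ℝ 2 μ := fun k => (hL k).toLp
  have : Fact ((2 : ENNReal) ≠ ⊤) := ⟨by simp⟩
  have hF : ∀ k, ‖F k‖ ≤ 1 := by
    intro k
    have := Lp.norm_le_of_ae_bound (f := F k) (C := 1) zero_le_one (by
      filter_upwards [(hL k).coeFn_toLp] with x hx
      rw [hx]; exact hb k x)
    have e : measureUnivNNReal μ = 1 := by simp [measureUnivNNReal, hμ, box_vol]
    simpa [e] using this
  let T : ℕ → WeakDual ℝ (Lp ℝ 2 μ) := fun k =>
    StrongDual.toWeakDual (InnerProductSpace.toDual ℝ (Lp ℝ 2 μ) (F k))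
  have hT : ∀ k, T k ∈ WeakDual.toStrongDual ⁻¹' Metric.closedBall (0 : StrongDual ℝ (Lp ℝ 2 μ)) 1 := by
    intro k
    simp only [Set.mem_preimage, mem_closedBall_zero_iff]
    exact ((InnerProductSpace.toDual ℝ (Lp ℝ 2 μ)).norm_map (F k)).le.trans (hF k)
  obtain ⟨T0, -, φ, hφ, hT0⟩ := WeakDual.isSeqCompact_closedBall ℝ (Lp ℝ 2 μ) 0 1 hT
  let G : Lp ℝ 2 μ := (InnerProductSpace.toDual ℝ (Lp ℝ 2 μ)).symm (WeakDual.toStrongDual T0)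
  have hGm : StronglyMeasurable G := Lp.stronglyMeasurable G
  refine ⟨φ, hφ, G, hGm.measurable, (Lp.memLp G).integrable (by norm_num), ?_⟩
  intro ψ hψ ⟨C, hC⟩
  have hψL : MemLp ψ 2 μ := MemLp.of_bound hψ.aestronglyMeasurable C (ae_of_all _ hC)
  have h1 : Tendsto (fun k => T (φ k) hψL.toLp) atTop (𝓝 (T0 hψL.toLp)) :=
    ((WeakDual.eval_continuous hψL.toLp).tendsto T0).comp hT0
  have e1 : ∀ k, T k hψL.toLp = ∫ x in unitBox d, ψ x * f k x := by
    intro k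
    change inner ℝ (F k) hψL.toLp = _
    rw [L2.inner_def]
    refine integral_congr_ae ?_
    filter_upwards [(hL k).coeFn_toLp, hψL.coeFn_toLp] with x hx hy
    rw [hx, hy]; simp
  have e2 : T0 hψL.toLp = ∫ x in unitBox d, ψ x * G x := by
    have : T0 hψL.toLp = inner ℝ G hψL.toLp := by
      simp only [G]
      rw [InnerProductSpace.toDual_symm_apply]; rfl
    rw [this, L2.inner_def]
    refine integral_congr_ae ?_
    filter_upwards [hψL.coeFn_toLp] with x hy
    rw [hy]; simp
  rw [← e2]
  simp_rw [← e1]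
  exact h1

lemma WC.comp {d : ℕ} {f : ℕ → (Fin d → ℝ) → ℝ} {g : (Fin d → ℝ) → ℝ} (h : WC f g) {φ : ℕ → ℕ}
    (hφ : StrictMono φ) : WC (fun k => f (φ k)) g :=
  fun ψ h1 h2 => (h ψ h1 h2).comp hφ.tendsto_atTop

lemma weak_compactN {d N : ℕ} (f : ℕ → (Fin d → ℝ) → Fin N → ℝ) (hm : ∀ k, Measurable (f k))
    (hb : ∀ k x i, |f k x i| ≤ 1) : ∃ φ : ℕ → ℕ, StrictMono φ ∧ ∃ g : Fin N → (Fin d → ℝ) → ℝ,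
      ∀ i, Measurable (g i) ∧ IntegrableOn (g i) (unitBox d) ∧
        WC (fun k x => f (φ k) x i) (g i) := by
  have key : ∀ s : Finset (Fin N), ∃ φ : ℕ → ℕ, StrictMono φ ∧ ∃ g : Fin N → (Fin d → ℝ) → ℝ,
      ∀ i ∈ s, Measurable (g i) ∧ IntegrableOn (g i) (unitBox d) ∧
        WC (fun k x => f (φ k) x i) (g i) := by
    intro s
    induction s using Finset.induction_on with
    | empty => exact ⟨id, strictMono_id, fun _ _ => 0, by simp⟩
    | insert j s hj ih =>
      obtain ⟨φ, hφ, g, hg⟩ := ih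
      obtain ⟨ψ, hψ, g', hg'm, hg'i, hg'w⟩ := weak_compact1 (fun k x => f (φ k) x j)
        (fun k => (measurable_pi_apply j).comp (hm _)) (fun k x => hb _ _ _)
      refine ⟨φ ∘ ψ, hφ.comp hψ, fun i => if i = j then g' else g i, fun i hi => ?_⟩
      by_cases hij : i = j
      · subst hij
        simp only [if_true]
        exact ⟨hg'm, hg'i, hg'w⟩
      · simp only [hij, if_false]
        obtain ⟨h1, h2, h3⟩ := hg i ((Finset.mem_insert.1 hi).resolve_left hij)
        exact ⟨h1, h2, h3.comp hψ⟩
  obtain ⟨φ, hφ, g, hg⟩ := key Finset.univ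
  exact ⟨φ, hφ, g, fun i => hg i (Finset.mem_univ i)⟩


lemma memM.bp {d N : ℕ} {u : (Fin d → ℝ) → Fin N → ℝ} (hu : memM u) (i : Fin N) :
    BP (fun x => u x i) := by
  obtain ⟨h1, h2, h3, _⟩ := hu
  refine ⟨(measurable_pi_apply i).comp h1, fun x k => ?_, 1, zero_le_one, fun x => ?_⟩
  · simp only [h2 x k]
  · rw [abs_le]
    have := h3 x i
    exact ⟨by linarith [this.1], this.2⟩

lemma memM.abs_le {d N : ℕ} {u : (Fin d → ℝ) → Fin N → ℝ} (hu : memM u) (x : Fin d → ℝ)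
    (i : Fin N) : |u x i| ≤ 1 := by
  rw [_root_.abs_le]
  have := hu.2.2.1 x i
  exact ⟨by linarith [this.1], this.2⟩

noncomputable def bq {d : ℕ} (t : ℝ) (f g : (Fin d → ℝ) → ℝ) : ℝ :=
  ∫ x in unitBox d, f x * conv (gs t) g x

noncomputable def cK (d : ℕ) (t h : ℝ) : ℝ :=
  h ^ (-(d : ℝ) / 2) * (4 * Real.pi * t) ^ (-(d : ℝ) / 2)

lemma cK_pos (d : ℕ) {t h : ℝ} (ht : 0 < t) (hh : 0 < h) : 0 < cK d t h := by
  unfold cK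
  have := Real.pi_pos
  positivity

lemma gs_unscale {d : ℕ} {t h : ℝ} (hh : 0 < h) (z : Fin d → ℝ) :
    gs t ((Real.sqrt h)⁻¹ • z) = gs (t * h) z := by
  unfold gs
  congr 1
  simp only [Pi.smul_apply, smul_eq_mul, mul_pow, inv_pow, Real.sq_sqrt hh.le, ← Finset.mul_sum]
  rw [← mul_assoc, ← div_div, neg_mul_eq_mul_neg, inv_mul_eq_div]
  ring

lemma Khij_eq {d : ℕ} {γ β h : ℝ} (hh : 0 < h) (a b : ℝ) (z : Fin d → ℝ) :
    Khij d γ β a b h z = a * cK d γ h * gs (γ * h) z + b * cK d β h * gs (β * h) z := by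
  rw [← gs_unscale hh, ← gs_unscale hh]
  unfold Khij heatK cK gs
  ring

lemma K_split {d : ℕ} {γ β h : ℝ} (hγ : 0 < γ) (hβ : 0 < β) (hh : 0 < h) (a b : ℝ)
    {f g : (Fin d → ℝ) → ℝ} (hf : BP f) (hg : BP g) :
    ∫ x in unitBox d, f x * conv (Khij d γ β a b h) g x =
      cK d γ h * (a * bq (γ * h) f g) + cK d β h * (b * bq (β * h) f g) := by
  have h1 : 0 < γ * h := by positivity
  have h2 : 0 < β * h := by positivity
  have e : ∀ x, conv (Khij d γ β a b h) g x =
      a * cK d γ h * conv (gs (γ * h)) g x + b * cK d β h * conv (gs (β * h)) g x := by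
    intro x
    unfold conv
    rw [← integral_const_mul, ← integral_const_mul,
      ← integral_add ((conv_integrable (gs_int h1) hg x).const_mul _)
        ((conv_integrable (gs_int h2) hg x).const_mul _)]
    congr 1; funext z
    rw [Khij_eq hh]; ring
  have i1 := (hf.mul (hg.conv (gs_meas _) (gs_int h1))).int
  have i2 := (hf.mul (hg.conv (gs_meas _) (gs_int h2))).int
  simp_rw [e]
  unfold bq
  rw [← integral_const_mul, ← integral_const_mul, ← integral_const_mul, ← integral_const_mul,
    ← integral_add ((i1.const_mul _).const_mul _) ((i2.const_mul _).const_mul _)]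
  congr 1; funext x; ring

noncomputable def SS {d N : ℕ} (c : Fin N → Fin N → ℝ) (t : ℝ) (f : Fin N → (Fin d → ℝ) → ℝ) : ℝ :=
  ∑ i, ∑ j, c i j * bq t (f i) (f j)

lemma sum_split {d N : ℕ} {γ β h : ℝ} (hγ : 0 < γ) (hβ : 0 < β) (hh : 0 < h)
    (a b : Fin N → Fin N → ℝ) {f : Fin N → (Fin d → ℝ) → ℝ} (hf : ∀ i, BP (f i)) :
    ∑ i, ∑ j, ∫ x in unitBox d, f i x * conv (Khij d γ β (a i j) (b i j) h) (f j) x =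
      cK d γ h * SS a (γ * h) f + cK d β h * SS b (β * h) f := by
  unfold SS
  simp_rw [K_split hγ hβ hh _ _ (hf _) (hf _), Finset.sum_add_distrib, Finset.mul_sum]

lemma conv_add_smul {d : ℕ} {t : ℝ} (ht : 0 < t) {f g : (Fin d → ℝ) → ℝ} (hf : BP f) (hg : BP g)
    (s : ℝ) (x : Fin d → ℝ) :
    conv (gs t) (fun x => f x + s * g x) x = conv (gs t) f x + s * conv (gs t) g x := by
  unfold conv
  rw [← integral_const_mul, ← integral_add (conv_integrable (gs_int ht) hf x)
    ((conv_integrable (gs_int ht) hg x).const_mul _)]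
  congr 1; funext z; ring

lemma bq_expand {d : ℕ} {t : ℝ} (ht : 0 < t) {f g f' g' : (Fin d → ℝ) → ℝ} (hf : BP f) (hg : BP g)
    (hf' : BP f') (hg' : BP g') (s : ℝ) :
    bq t (fun x => f x + s * g x) (fun x => f' x + s * g' x) =
      bq t f f' + s * (bq t f g' + bq t g f') + s ^ 2 * bq t g g' := by
  have c := fun {g : (Fin d → ℝ) → ℝ} (hg : BP g) => hg.conv (gs_meas t) (gs_int ht)
  unfold bq
  simp_rw [conv_add_smul ht hf' hg']
  have i1 := (hf.mul (c hf')).int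
  have i2 := (hf.mul (c hg')).int
  have i3 := (hg.mul (c hf')).int
  have i4 := (hg.mul (c hg')).int
  have i23 : IntegrableOn (fun x => s * (f x * conv (gs t) g' x + g x * conv (gs t) f' x))
    (unitBox d) := (i2.add i3).const_mul s
  have i123 : IntegrableOn (fun x => f x * conv (gs t) f' x +
    s * (f x * conv (gs t) g' x + g x * conv (gs t) f' x)) (unitBox d) := i1.add i23
  rw [← integral_add i2 i3, ← integral_const_mul, ← integral_const_mul,
    ← integral_add i1 i23, ← integral_add i123 (i4.const_mul _)]
  congr 1; funext x; ring

lemma SS_expand {d N : ℕ} {t : ℝ} (ht : 0 < t) (c : Fin N → Fin N → ℝ)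
    {f g : Fin N → (Fin d → ℝ) → ℝ} (hf : ∀ i, BP (f i)) (hg : ∀ i, BP (g i)) :
    ∃ B, ∀ s : ℝ, SS c t (fun i x => f i x + s * g i x) = SS c t f + s * B + s ^ 2 * SS c t g := by
  refine ⟨∑ i, ∑ j, c i j * (bq t (f i) (g j) + bq t (g i) (f j)), fun s => ?_⟩
  unfold SS
  simp_rw [bq_expand ht (hf _) (hg _) (hf _) (hg _), Finset.mul_sum, ← Finset.sum_add_distrib]
  refine Finset.sum_congr rfl fun i _ => Finset.sum_congr rfl fun j _ => ?_
  ring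

lemma SS_eq {d N : ℕ} {t : ℝ} (ht : 0 < t) (c : Fin N → Fin N → ℝ)
    {f : Fin N → (Fin d → ℝ) → ℝ} (hf : ∀ i, BP (f i)) :
    cg d (t / 2) * (-SS c t f) = ∫ x in unitBox d, ∑ i, ∑ j,
      conv (gs (t / 2)) (f i) x * (-(c i j)) * conv (gs (t / 2)) (f j) x := by
  have ht2 := half_pos ht
  have hc := fun i => (hf i).conv (gs_meas (t / 2)) (gs_int ht2)
  have hi : ∀ i j, IntegrableOn (fun x => conv (gs (t / 2)) (f i) x * (-(c i j)) *
      conv (gs (t / 2)) (f j) x) (unitBox d) := fun i j =>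
    (((hc i).mul (BP.const (-(c i j)))).mul (hc j)).int
  rw [integral_finsetSum _ fun i _ => integrable_finsetSum _ fun j _ => hi i j]
  unfold SS
  rw [← Finset.sum_neg_distrib, Finset.mul_sum]
  refine Finset.sum_congr rfl fun i _ => ?_
  rw [integral_finsetSum _ fun j _ => hi i j, ← Finset.sum_neg_distrib, Finset.mul_sum]
  refine Finset.sum_congr rfl fun j _ => ?_
  have := q_double ht2 (hf i) (hf j)
  rw [mul_div_cancel₀ t two_ne_zero] at this
  unfold bq
  have e : ∀ x, conv (gs (t / 2)) (f i) x * (-(c i j)) * conv (gs (t / 2)) (f j) x =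
    -(c i j) * (conv (gs (t / 2)) (f i) x * conv (gs (t / 2)) (f j) x) := fun x => by ring
  simp_rw [e]
  rw [integral_const_mul, ← this]
  ring

lemma conv_sum_zero {d N : ℕ} {t : ℝ} (ht : 0 < t)
    {f : Fin N → (Fin d → ℝ) → ℝ} (hf : ∀ i, BP (f i)) (h0 : ∀ᵐ x, ∑ i, f i x = 0)
    (x : Fin d → ℝ) : ∑ i, conv (gs t) (f i) x = 0 := by
  unfold conv
  rw [← integral_finsetSum _ fun i _ => conv_integrable (gs_int ht) (hf i) x]
  refine integral_eq_zero_of_ae ?_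
  have := (Measure.measurePreserving_sub_left volume x).quasiMeasurePreserving.ae h0
  filter_upwards [this] with z hz
  rw [← Finset.mul_sum, hz, mul_zero]; rfl

lemma SS_pointwise {N : ℕ} {c : Fin N → Fin N → ℝ}
    (hA : ∀ v : Fin N → ℝ, v ≠ 0 → ∑ i, v i = 0 → 0 < ∑ i, ∑ j, v i * (-(c i j)) * v j)
    (v : Fin N → ℝ) (hv : ∑ i, v i = 0) : 0 ≤ ∑ i, ∑ j, v i * (-(c i j)) * v j := by
  by_cases h : v = 0
  · simp [h]
  · exact (hA v h hv).le

lemma SS_nonneg {d N : ℕ} {t : ℝ} (ht : 0 < t) {c : Fin N → Fin N → ℝ}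
    (hA : ∀ v : Fin N → ℝ, v ≠ 0 → ∑ i, v i = 0 → 0 < ∑ i, ∑ j, v i * (-(c i j)) * v j)
    {f : Fin N → (Fin d → ℝ) → ℝ} (hf : ∀ i, BP (f i)) (h0 : ∀ᵐ x, ∑ i, f i x = 0) :
    0 ≤ -SS c t f := by
  have h1 : 0 ≤ cg d (t / 2) * (-SS c t f) := by
    rw [SS_eq ht c hf]
    exact integral_nonneg fun x => SS_pointwise hA _ (conv_sum_zero (half_pos ht) hf h0 x)
  exact nonneg_of_mul_nonneg_right h1 (cg_pos d (half_pos ht))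

lemma SS_inj {d N : ℕ} {t : ℝ} (ht : 0 < t) {c : Fin N → Fin N → ℝ}
    (hA : ∀ v : Fin N → ℝ, v ≠ 0 → ∑ i, v i = 0 → 0 < ∑ i, ∑ j, v i * (-(c i j)) * v j)
    {f : Fin N → (Fin d → ℝ) → ℝ} (hf : ∀ i, BP (f i)) (h0 : ∀ᵐ x, ∑ i, f i x = 0)
    (h : SS c t f = 0) (i : Fin N) : ∀ᵐ x, f i x = 0 := by
  have ht2 := half_pos ht
  have hc := fun i => (hf i).conv (gs_meas (t / 2)) (gs_int ht2)
  have h1 := SS_eq ht c hf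
  rw [h, neg_zero, mul_zero] at h1
  have hz := conv_sum_zero ht2 hf h0
  have hi : IntegrableOn (fun x => ∑ i, ∑ j, conv (gs (t / 2)) (f i) x * (-(c i j)) *
      conv (gs (t / 2)) (f j) x) (unitBox d) :=
    integrable_finsetSum _ fun i _ => integrable_finsetSum _ fun j _ =>
      (((hc i).mul (BP.const (-(c i j)))).mul (hc j)).int
  have h2 := (integral_eq_zero_iff_of_nonneg (fun x => SS_pointwise hA _ (hz x)) hi).1 h1.symm
  have h3 := q_double ht2 (hf i) (hf i)
  rw [mul_div_cancel₀ t two_ne_zero] at h3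
  have h4 : ∫ x in unitBox d, conv (gs (t / 2)) (f i) x * conv (gs (t / 2)) (f i) x = 0 := by
    refine integral_eq_zero_of_ae ?_
    filter_upwards [h2] with x hx
    have : (fun i => conv (gs (t / 2)) (f i) x) = 0 := by
      by_contra hne
      exact (hA _ hne (hz x)).ne' hx
    have := congrFun this i
    simp only [Pi.zero_apply] at this ⊢
    rw [this, mul_zero]
  rw [h4] at h3
  exact q_inj (hf i) ht ((mul_eq_zero.1 h3).resolve_left (cg_pos d ht2).ne')

lemma sqrt_quad {A B C : ℝ} (hA : 0 ≤ A) (hC : 0 ≤ C) (h : ∀ s : ℝ, 0 ≤ A + s * B + s ^ 2 * C) :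
    Real.sqrt (A + B + C) ≤ Real.sqrt A + Real.sqrt C := by
  have hd : discrim C B A ≤ 0 := discrim_le_zero fun s => by
    have := h s; nlinarith
  unfold discrim at hd
  rw [Real.sqrt_le_left (by positivity)]
  have hB : B ≤ 2 * (Real.sqrt A * Real.sqrt C) := by
    refine (le_abs_self B).trans (abs_le_of_sq_le_sq ?_ (by positivity))
    have h1 := Real.sq_sqrt hA
    have h2 := Real.sq_sqrt hC
    calc B ^ 2 ≤ 4 * (A * C) := by linarith
      _ = _ := by rw [mul_pow, mul_pow, h1, h2]; ring
  nlinarith [Real.sq_sqrt hA, Real.sq_sqrt hC]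

/-- vector-level weak convergence -/
def WCN {d N : ℕ} (uk : ℕ → (Fin d → ℝ) → Fin N → ℝ) (u : (Fin d → ℝ) → Fin N → ℝ) : Prop :=
  ∀ i, WC (fun k x => uk k x i) (fun x => u x i)

lemma SS_wc {d N : ℕ} {t : ℝ} (ht : 0 < t) (c : Fin N → Fin N → ℝ)
    {f : ℕ → Fin N → (Fin d → ℝ) → ℝ} {g : Fin N → (Fin d → ℝ) → ℝ}
    (hf : ∀ k i, BP (f k i)) (hg : ∀ i, BP (g i)) {C : ℝ} (hC : ∀ k i x, |f k i x| ≤ C)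
    (h : ∀ i, WC (fun k => f k i) (g i)) :
    Tendsto (fun k => SS c t (f k)) atTop (𝓝 (SS c t g)) := by
  unfold SS bq
  refine tendsto_finsetSum _ fun i _ => tendsto_finsetSum _ fun j _ => Tendsto.const_mul _ ?_
  exact q_wc ht (fun k => hf k i) (fun k => hC k i) (h i) (fun k => hf k j) (hg j)
    (fun k => hC k j) (h j)

lemma WC.sub_lim {d : ℕ} {f : ℕ → (Fin d → ℝ) → ℝ} {g : (Fin d → ℝ) → ℝ} (hf : ∀ k, BP (f k))
    (hg : BP g) (h : WC f g) : WC (fun k x => f k x - g x) (fun _ => 0) := by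
  intro φ hφ ⟨C, hC⟩
  have h1 := (h φ hφ ⟨C, hC⟩).sub_const (∫ x in unitBox d, φ x * g x)
  rw [sub_self] at h1
  simp only [mul_zero, integral_zero]
  refine h1.congr fun k => ?_
  have hi : ∀ {w}, BP w → IntegrableOn (fun x => φ x * w x) (unitBox d) := fun {w} hw =>
    hw.int.bdd_mul (c := C) hφ.aestronglyMeasurable (ae_of_all _ hC)
  rw [← integral_sub (hi (hf k)) (hi hg)]
  congr 1; funext x; ring

lemma weak_compactM {d N : ℕ} (uk : ℕ → (Fin d → ℝ) → Fin N → ℝ) (hu : ∀ k, memM (uk k)) :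
    ∃ φ : ℕ → ℕ, StrictMono φ ∧ ∃ u : (Fin d → ℝ) → Fin N → ℝ, memM u ∧
      WCN (fun k => uk (φ k)) u := by
  obtain ⟨φ, hφ, g, hg⟩ := weak_compactN uk (fun k => (hu k).1) (fun k x i => (hu k).abs_le x i)
  -- set integrals
  have hset : ∀ i s, MeasurableSet s → Tendsto (fun k => ∫ x in s, uk (φ k) x i
      ∂(volume.restrict (unitBox d))) atTop (𝓝 (∫ x in s, g i x ∂(volume.restrict (unitBox d)))) := by
    intro i s hs
    have h1 := (hg i).2.2 (s.indicator fun _ => 1) (measurable_const.indicator hs) ⟨1, fun x => by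
      by_cases hx : x ∈ s <;> simp [hx]⟩
    have e : ∀ w : (Fin d → ℝ) → ℝ, ∫ x in unitBox d, (s.indicator (fun _ => (1 : ℝ)) x) * w x =
        ∫ x in s, w x ∂(volume.restrict (unitBox d)) := by
      intro w
      rw [← integral_indicator hs]
      congr 1; funext x
      by_cases hx : x ∈ s <;> simp [hx]
    simp_rw [e] at h1
    exact h1
  have hui : ∀ k i, Integrable (fun x => uk k x i) (volume.restrict (unitBox d)) :=
    fun k i => ((hu k).bp i).int
  have hge0 : ∀ i, 0 ≤ᵐ[volume.restrict (unitBox d)] g i := by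
    intro i
    refine ae_nonneg_of_forall_setIntegral_nonneg (hg i).2.1 fun s hs _ => ?_
    exact ge_of_tendsto' (hset i s hs) fun k => integral_nonneg fun x => ((hu _).2.2.1 x i).1
  have hle1 : ∀ i, g i ≤ᵐ[volume.restrict (unitBox d)] fun _ => 1 := by
    intro i
    refine ae_le_of_forall_setIntegral_le (hg i).2.1 (integrable_const _) fun s hs _ => ?_
    refine le_of_tendsto' (hset i s hs) fun k => ?_
    exact integral_mono (hui _ i).integrableOn (integrable_const _) fun x => ((hu _).2.2.1 x i).2
  have hsum : (fun x => ∑ i, g i x) =ᵐ[volume.restrict (unitBox d)] fun _ => 1 := by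
    refine Integrable.ae_eq_of_forall_setIntegral_eq _ _
      (integrable_finsetSum _ fun i _ => (hg i).2.1) (integrable_const _) fun s hs _ => ?_
    rw [integral_finsetSum _ fun i _ => ((hg i).2.1).integrableOn]
    refine tendsto_nhds_unique (tendsto_finsetSum _ fun i _ => hset i s hs) ?_
    refine tendsto_const_nhds.congr fun k => ?_
    rw [← integral_finsetSum _ fun i _ => (hui _ i).integrableOn]
    refine integral_congr_ae ?_
    filter_upwards [ae_restrict_of_ae (ae_restrict_of_ae (hu (φ k)).2.2.2)] with x hx
    exact hx.symm
  let fr : (Fin d → ℝ) → (Fin d → ℝ) := fun x i => Int.fract (x i)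
  have hfr : Measurable fr := measurable_pi_lambda _ fun i =>
    measurable_fract.comp (measurable_pi_apply i)
  have hfrp : ∀ x (k : Fin d → ℤ), fr (x + fun i => (k i : ℝ)) = fr x := by
    intro x k; funext i; simp [fr]
  have hfrb : ∀ x ∈ unitBox d, fr x = x := by
    intro x hx; funext i
    have := hx i (Set.mem_univ i)
    exact Int.fract_eq_self.2 this
  let u : (Fin d → ℝ) → Fin N → ℝ := fun x i => max 0 (min 1 (g i (fr x)))
  have hug : ∀ᵐ x ∂(volume.restrict (unitBox d)), ∀ i, u x i = g i x := by
    rw [ae_all_iff]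
    intro i
    filter_upwards [hge0 i, hle1 i, ae_restrict_mem (box_meas d)] with x h1 h2 h3
    simp only [u, hfrb x h3]
    rw [min_eq_right (show g i x ≤ 1 from h2), max_eq_right (show (0 : ℝ) ≤ g i x from h1)]
  refine ⟨φ, hφ, u, ⟨?_, ?_, ?_, ?_⟩, ?_⟩
  · refine measurable_pi_lambda _ fun i => ?_
    exact measurable_const.max (measurable_const.min ((hg i).1.comp hfr))
  · intro x k
    simp only [u, hfrp x k]
  · intro x i
    exact ⟨le_max_left _ _, max_le zero_le_one (min_le_left _ _)⟩
  · refine ae_of_box (p := fun x => ∑ i, u x i = 1) (fun x k => ?_) ?_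
    · simp only [u, hfrp x k]
    · filter_upwards [hug, hsum] with x h1 h2
      simp_rw [h1]; exact h2
  · intro i ψ h1 h2
    have := (hg i).2.2 ψ h1 h2
    convert this using 2
    refine integral_congr_ae ?_
    filter_upwards [hug] with x hx
    simp only [hx i]

lemma dsq_eq {d N : ℕ} {γ β h : ℝ} (hγ : 0 < γ) (hβ : 0 < β) (hh : 0 < h)
    (a b : Fin N → Fin N → ℝ) {u v : (Fin d → ℝ) → Fin N → ℝ} (hu : memM u) (hv : memM v) :
    dsq γ β a b h u v = 2 * Real.sqrt h *
      (cK d γ h * (-SS a (γ * h) (fun i x => u x i - v x i)) +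
       cK d β h * (-SS b (β * h) (fun i x => u x i - v x i))) := by
  have := sum_split hγ hβ hh a b (f := fun i x => u x i - v x i)
    (fun i => (hu.bp i).sub (hv.bp i))
  unfold dsq
  rw [this]; ring

lemma Eh_eq {d N : ℕ} {γ β h : ℝ} (hγ : 0 < γ) (hβ : 0 < β) (hh : 0 < h)
    (a b : Fin N → Fin N → ℝ) {u : (Fin d → ℝ) → Fin N → ℝ} (hu : memM u) :
    Eh γ β a b h u = (Real.sqrt h)⁻¹ *
      (cK d γ h * SS a (γ * h) (fun i x => u x i) + cK d β h * SS b (β * h) (fun i x => u x i)) := by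
  have := sum_split hγ hβ hh a b (f := fun i x => u x i) (fun i => hu.bp i)
  unfold Eh
  rw [this]

lemma sub_sum_zero {d N : ℕ} {u v : (Fin d → ℝ) → Fin N → ℝ} (hu : memM u) (hv : memM v) :
    ∀ᵐ x, ∑ i, (u x i - v x i) = 0 := by
  filter_upwards [hu.2.2.2, hv.2.2.2] with x h1 h2
  rw [Finset.sum_sub_distrib, h1, h2, sub_self]

lemma SS_neg {d N : ℕ} (c : Fin N → Fin N → ℝ) (t : ℝ) (u v : (Fin d → ℝ) → Fin N → ℝ) :
    SS c t (fun i x => u x i - v x i) = SS c t (fun i x => v x i - u x i) := by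
  unfold SS bq conv
  refine Finset.sum_congr rfl fun i _ => Finset.sum_congr rfl fun j _ => ?_
  congr 2
  funext x
  have : ∫ z, gs t z * (u (x - z) j - v (x - z) j) = -∫ z, gs t z * (v (x - z) j - u (x - z) j) := by
    rw [← integral_neg]; congr 1; funext z; ring
  rw [this]; ring

lemma SS_zero_of_ae {d N : ℕ} (c : Fin N → Fin N → ℝ) (t : ℝ) {f : Fin N → (Fin d → ℝ) → ℝ}
    (h : ∀ i, ∀ᵐ x, f i x = 0) : SS c t f = 0 := by
  unfold SS bq
  refine Finset.sum_eq_zero fun i _ => Finset.sum_eq_zero fun j _ => ?_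
  rw [integral_eq_zero_of_ae, mul_zero]
  filter_upwards [ae_restrict_of_ae (h i)] with x hx
  rw [hx, zero_mul]; rfl

lemma dh_wc {d N : ℕ} {γ β h : ℝ} (hγ : 0 < γ) (hβ : 0 < β) (hh : 0 < h)
    (a b : Fin N → Fin N → ℝ) {uk : ℕ → (Fin d → ℝ) → Fin N → ℝ} {u : (Fin d → ℝ) → Fin N → ℝ}
    (huk : ∀ k, memM (uk k)) (hu : memM u) (hw : WCN uk u) :
    Tendsto (fun k => dh γ β a b h (uk k) u) atTop (𝓝 0) := by
  have key : ∀ (c : Fin N → Fin N → ℝ) {t : ℝ}, 0 < t →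
      Tendsto (fun k => SS c t (fun i x => uk k x i - u x i)) atTop (𝓝 0) := by
    intro c t ht
    have h1 := SS_wc ht c (f := fun k i x => uk k x i - u x i) (g := fun _ _ => 0)
      (fun k i => ((huk k).bp i).sub (hu.bp i)) (fun _ => BP.const 0) (C := 2)
      (fun k i x => by
        have h1 := (huk k).abs_le x i
        have h2 := hu.abs_le x i
        exact (abs_sub _ _).trans (by linarith))
      (fun i => WC.sub_lim (fun k => (huk k).bp i) (hu.bp i) (hw i))
    rwa [SS_zero_of_ae c t (fun i => ae_of_all _ fun x => rfl)] at h1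
  have h2 : Tendsto (fun k => dsq γ β a b h (uk k) u) atTop (𝓝 0) := by
    have := (((key a (mul_pos hγ hh)).neg.const_mul (cK d γ h)).add
      ((key b (mul_pos hβ hh)).neg.const_mul (cK d β h))).const_mul (2 * Real.sqrt h)
    simp only [neg_zero, mul_zero, add_zero] at this
    exact this.congr fun k => (dsq_eq hγ hβ hh a b (huk k) hu).symm
  have h3 := (Real.continuous_sqrt.tendsto 0).comp h2
  rw [Real.sqrt_zero] at h3
  exact h3

lemma Eh_wc {d N : ℕ} {γ β h : ℝ} (hγ : 0 < γ) (hβ : 0 < β) (hh : 0 < h)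
    (a b : Fin N → Fin N → ℝ) {uk : ℕ → (Fin d → ℝ) → Fin N → ℝ} {u : (Fin d → ℝ) → Fin N → ℝ}
    (huk : ∀ k, memM (uk k)) (hu : memM u) (hw : WCN uk u) :
    Tendsto (fun k => Eh γ β a b h (uk k)) atTop (𝓝 (Eh γ β a b h u)) := by
  have key : ∀ (c : Fin N → Fin N → ℝ) {t : ℝ}, 0 < t →
      Tendsto (fun k => SS c t (fun i x => uk k x i)) atTop (𝓝 (SS c t (fun i x => u x i))) := by
    intro c t ht
    exact SS_wc ht c (f := fun k i x => uk k x i) (g := fun i x => u x i)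
      (fun k i => (huk k).bp i) (fun i => hu.bp i) (C := 1) (fun k i x => (huk k).abs_le x i) hw
  rw [Eh_eq hγ hβ hh a b hu]
  have := (((key a (mul_pos hγ hh)).const_mul (cK d γ h)).add
      ((key b (mul_pos hβ hh)).const_mul (cK d β h))).const_mul (Real.sqrt h)⁻¹
  exact this.congr fun k => (Eh_eq hγ hβ hh a b (huk k)).symm

/-- `(ℳ, d_h)` is a compact metric space (identifying a.e. equal functions)
and `E_h` is continuous with respect to `d_h`. -/
theorem stmt_5 (d N : ℕ) (γ β h : ℝ) (hβ0 : 0 < β) (hβγ : β < γ) (hh : 0 < h)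
    (a b : Fin N → Fin N → ℝ)
    (hasymm : ∀ i j, a i j = a j i) (hbsymm : ∀ i j, b i j = b j i)
    (hadiag : ∀ i, a i i = 0) (hbdiag : ∀ i, b i i = 0)
    (hA : ∀ v : Fin N → ℝ, v ≠ 0 → ∑ i, v i = 0 → 0 < ∑ i, ∑ j, v i * (-(a i j)) * v j)
    (hB : ∀ v : Fin N → ℝ, v ≠ 0 → ∑ i, v i = 0 → 0 < ∑ i, ∑ j, v i * (-(b i j)) * v j) :
    -- (i) `d_h` is a metric on `ℳ` after identifying a.e. equal functions
    (∀ u v : (Fin d → ℝ) → Fin N → ℝ, memM u → memM v → 0 ≤ dsq γ β a b h u v) ∧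
    (∀ u v : (Fin d → ℝ) → Fin N → ℝ, memM u → memM v →
      (dh γ β a b h u v = 0 ↔ u =ᵐ[(volume : Measure (Fin d → ℝ))] v)) ∧
    (∀ u v : (Fin d → ℝ) → Fin N → ℝ, memM u → memM v →
      dh γ β a b h u v = dh γ β a b h v u) ∧
    (∀ u v w : (Fin d → ℝ) → Fin N → ℝ, memM u → memM v → memM w →
      dh γ β a b h u w ≤ dh γ β a b h u v + dh γ β a b h v w) ∧
    -- (ii) `(ℳ, d_h)` is compact
    (∀ uk : ℕ → (Fin d → ℝ) → Fin N → ℝ, (∀ k, memM (uk k)) →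
      ∃ φ : ℕ → ℕ, StrictMono φ ∧ ∃ u : (Fin d → ℝ) → Fin N → ℝ, memM u ∧
        Tendsto (fun k => dh γ β a b h (uk (φ k)) u) atTop (𝓝 0)) ∧
    -- (iii) `E_h` is continuous with respect to `d_h`
    (∀ (uk : ℕ → (Fin d → ℝ) → Fin N → ℝ) (u : (Fin d → ℝ) → Fin N → ℝ),
      (∀ k, memM (uk k)) → memM u →
      Tendsto (fun k => dh γ β a b h (uk k) u) atTop (𝓝 0) →
      Tendsto (fun k => Eh γ β a b h (uk k)) atTop (𝓝 (Eh γ β a b h u))) := by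
  have hγ : 0 < γ := hβ0.trans hβγ
  have hγh : 0 < γ * h := mul_pos hγ hh
  have hβh : 0 < β * h := mul_pos hβ0 hh
  have cγ := cK_pos d hγ hh
  have cβ := cK_pos d hβ0 hh
  have hsq : 0 < Real.sqrt h := Real.sqrt_pos.2 hh
  have P0 : ∀ f : Fin N → (Fin d → ℝ) → ℝ, (∀ i, BP (f i)) → (∀ᵐ x, ∑ i, f i x = 0) →
      0 ≤ 2 * Real.sqrt h * (cK d γ h * (-SS a (γ * h) f) + cK d β h * (-SS b (β * h) f)) := by
    intro f hf h0
    have h1 := SS_nonneg hγh hA hf h0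
    have h2 := SS_nonneg hβh hB hf h0
    positivity
  have Hnn : ∀ u v : (Fin d → ℝ) → Fin N → ℝ, memM u → memM v → 0 ≤ dsq γ β a b h u v := by
    intro u v hu hv
    rw [dsq_eq hγ hβ0 hh a b hu hv]
    exact P0 _ (fun i => (hu.bp i).sub (hv.bp i)) (sub_sum_zero hu hv)
  have Hz : ∀ u v : (Fin d → ℝ) → Fin N → ℝ, memM u → memM v →
      (dh γ β a b h u v = 0 ↔ u =ᵐ[(volume : Measure (Fin d → ℝ))] v) := by
    intro u v hu hv
    unfold dh
    rw [Real.sqrt_eq_zero (Hnn u v hu hv), dsq_eq hγ hβ0 hh a b hu hv]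
    have hbp : ∀ i, BP (fun x => u x i - v x i) := fun i => (hu.bp i).sub (hv.bp i)
    constructor
    · intro h0
      have h1 := SS_nonneg hγh hA hbp (sub_sum_zero hu hv)
      have h2 := SS_nonneg hβh hB hbp (sub_sum_zero hu hv)
      have h3 := (mul_eq_zero.1 h0).resolve_left (by positivity)
      have h4 := mul_nonneg cγ.le h1
      have h5 := mul_nonneg cβ.le h2
      have h6 := (mul_eq_zero.1 (show cK d γ h * (-SS a (γ * h) fun i x => u x i - v x i) = 0 by
        linarith)).resolve_left cγ.ne'
      have h7 := SS_inj hγh hA hbp (sub_sum_zero hu hv) (neg_eq_zero.1 h6)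
      filter_upwards [ae_all_iff.2 h7] with x hx
      funext i
      exact sub_eq_zero.1 (hx i)
    · intro huv
      have hz : ∀ i, ∀ᵐ x, u x i - v x i = 0 := by
        intro i
        filter_upwards [huv] with x hx
        rw [hx, sub_self]
      rw [SS_zero_of_ae a _ hz, SS_zero_of_ae b _ hz]
      simp
  have Hs : ∀ u v : (Fin d → ℝ) → Fin N → ℝ, memM u → memM v →
      dh γ β a b h u v = dh γ β a b h v u := by
    intro u v hu hv
    unfold dh
    rw [dsq_eq hγ hβ0 hh a b hu hv, dsq_eq hγ hβ0 hh a b hv hu, SS_neg a, SS_neg b]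
  have Ht : ∀ u v w : (Fin d → ℝ) → Fin N → ℝ, memM u → memM v → memM w →
      dh γ β a b h u w ≤ dh γ β a b h u v + dh γ β a b h v w := by
    intro u v w hu hv hw
    have hf : ∀ i, BP (fun x => u x i - v x i) := fun i => (hu.bp i).sub (hv.bp i)
    have hg : ∀ i, BP (fun x => v x i - w x i) := fun i => (hv.bp i).sub (hw.bp i)
    have hfs := sub_sum_zero hu hv
    have hgs := sub_sum_zero hv hw
    obtain ⟨Ba, hBa⟩ := SS_expand hγh a hf hg
    obtain ⟨Bb, hBb⟩ := SS_expand hβh b hf hg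
    have A0 := Hnn u v hu hv
    have C0 := Hnn v w hv hw
    have hq := sqrt_quad (B := 2 * Real.sqrt h * (cK d γ h * (-Ba) + cK d β h * (-Bb))) A0 C0
      (by
        intro s
        have h1 := P0 (fun i x => (u x i - v x i) + s * (v x i - w x i))
          (fun i => (hf i).add ((BP.const s).mul (hg i))) (by
            filter_upwards [hfs, hgs] with x h1 h2
            rw [Finset.sum_add_distrib, ← Finset.mul_sum, h1, h2, mul_zero, add_zero])
        rw [hBa s, hBb s] at h1
        rw [dsq_eq hγ hβ0 hh a b hu hv, dsq_eq hγ hβ0 hh a b hv hw]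
        refine h1.trans_eq ?_
        ring)
    unfold dh
    refine le_of_eq_of_le ?_ hq
    congr 1
    have e : (fun (i : Fin N) (x : Fin d → ℝ) => u x i - w x i) =
        fun i x => (u x i - v x i) + 1 * (v x i - w x i) := by
      funext i x; ring
    rw [dsq_eq hγ hβ0 hh a b hu hv, dsq_eq hγ hβ0 hh a b hv hw, dsq_eq hγ hβ0 hh a b hu hw, e,
      hBa 1, hBb 1]
    ring
  refine ⟨Hnn, Hz, Hs, Ht, ?_, ?_⟩
  · intro uk huk
    obtain ⟨φ, hφ, u, hu, hw⟩ := weak_compactM uk huk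
    exact ⟨φ, hφ, u, hu, dh_wc hγ hβ0 hh a b (fun k => huk _) hu hw⟩
  · intro uk u huk hu hd
    refine tendsto_of_subseq_tendsto fun ns hns => ?_
    obtain ⟨φ, hφ, v, hv, hw⟩ := weak_compactM (fun k => uk (ns k)) (fun k => huk _)
    refine ⟨φ, ?_⟩
    have hd1 := dh_wc hγ hβ0 hh a b (fun k => huk _) hv hw
    have hd2 := hd.comp (hns.comp hφ.tendsto_atTop)
    have h0 : dh γ β a b h u v ≤ 0 := by
      have h3 := hd2.add hd1
      rw [add_zero] at h3
      refine ge_of_tendsto' h3 fun k => ?_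
      have := Ht u (uk (ns (φ k))) v hu (huk _) hv
      rw [Hs u _ hu (huk _)] at this
      exact this
    have h1 : u =ᵐ[volume] v := (Hz u v hu hv).1 (le_antisymm h0 (Real.sqrt_nonneg _))
    refine Eh_wc hγ hβ0 hh a b (fun k => huk _) hu fun i ψ h2 h3 => ?_
    have h4 := hw i ψ h2 h3
    convert h4 using 2
    refine integral_congr_ae ?_
    filter_upwards [ae_restrict_of_ae h1] with x hx
    simp only [hx]
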